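/- A topological space X is normal if and only if every closed subset of X is 0-embedded in X. -/

import Mathlib

open Set

universe u v

/-- `A` is functionally open in `X`: `A = f⁻¹((0,1])` for some continuous `f : X → [0,1]`. -/
def FunctionallyOpen (X : Type u) [TopologicalSpace X] (A : Set X) : Prop :=
  ∃ f : X → ℝ, Continuous f ∧ (∀ x, f x ∈ Set.Icc (0:ℝ) 1) ∧ A = f ⁻¹' (Set.Ioc 0 1)

/-- `A` is functionally closed in `X`: `A = f⁻¹(0)` for some continuous `f : X → [0,1]`. -/
def FunctionallyClosed (X : Type u) [TopologicalSpace X] (A : Set X) : Prop :=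
  ∃ f : X → ℝ, Continuous f ∧ (∀ x, f x ∈ Set.Icc (0:ℝ) 1) ∧ A = f ⁻¹' {0}

mutual
/-- The `α`'th functionally additive class in `X`. -/
inductive FunAdd (X : Type u) [TopologicalSpace X] : Ordinal.{0} → Set X → Prop where
  | base (A : Set X) : FunctionallyOpen X A → FunAdd X 0 A
  | union (α : Ordinal.{0}) (hα : α ≠ 0) (β : ℕ → Ordinal.{0}) (hβ : ∀ n, β n < α)
      (s : ℕ → Set X) (hs : ∀ n, FunMul X (β n) (s n)) : FunAdd X α (⋃ n, s n)

/-- The `α`'th functionally multiplicative class in `X`. -/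
inductive FunMul (X : Type u) [TopologicalSpace X] : Ordinal.{0} → Set X → Prop where
  | base (A : Set X) : FunctionallyClosed X A → FunMul X 0 A
  | inter (α : Ordinal.{0}) (hα : α ≠ 0) (β : ℕ → Ordinal.{0}) (hβ : ∀ n, β n < α)
      (s : ℕ → Set X) (hs : ∀ n, FunAdd X (β n) (s n)) : FunMul X α (⋂ n, s n)
end

mutual
/-- The `α`'th (ordinary) additive Borel class in `X`. -/
inductive BorelAdd (X : Type u) [TopologicalSpace X] : Ordinal.{0} → Set X → Prop where
  | base (A : Set X) : IsOpen A → BorelAdd X 0 A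
  | union (α : Ordinal.{0}) (hα : α ≠ 0) (β : ℕ → Ordinal.{0}) (hβ : ∀ n, β n < α)
      (s : ℕ → Set X) (hs : ∀ n, BorelMul X (β n) (s n)) : BorelAdd X α (⋃ n, s n)

/-- The `α`'th (ordinary) multiplicative Borel class in `X`. -/
inductive BorelMul (X : Type u) [TopologicalSpace X] : Ordinal.{0} → Set X → Prop where
  | base (A : Set X) : IsClosed A → BorelMul X 0 A
  | inter (α : Ordinal.{0}) (hα : α ≠ 0) (β : ℕ → Ordinal.{0}) (hβ : ∀ n, β n < α)
      (s : ℕ → Set X) (hs : ∀ n, BorelAdd X (β n) (s n)) : BorelMul X α (⋂ n, s n)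
end

/-- A set is functionally ambiguous of class `α` if it belongs to both the `α`'th functionally
additive and the `α`'th functionally multiplicative class. -/
def FunAmbiguous (X : Type u) [TopologicalSpace X] (α : Ordinal.{0}) (A : Set X) : Prop :=
  FunAdd X α A ∧ FunMul X α A

/-- `f ∈ K_α(X,Y)`: for `α = 0` continuity, for `α > 0` preimages of open sets belong to
the `α`'th functionally additive class. -/
def KClass {X : Type u} {Y : Type v} [TopologicalSpace X] [TopologicalSpace Y]
    (α : Ordinal.{0}) (f : X → Y) : Prop :=
  (α = 0 → Continuous f) ∧ (α ≠ 0 → ∀ V : Set Y, IsOpen V → FunAdd X α (f ⁻¹' V))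

/-- `A` and `B` are `α`-separated in `X`. -/
def AlphaSeparated {X : Type u} [TopologicalSpace X] (α : Ordinal.{0}) (A B : Set X) : Prop :=
  ∃ f : X → ℝ, KClass α f ∧ A ⊆ f ⁻¹' {0} ∧ B ⊆ f ⁻¹' {1}

/-- `X` is an `α`-separated space: any two disjoint sets of the `α`'th (ordinary)
multiplicative class are `α`-separated. -/
def AlphaSeparatedSpace (X : Type u) [TopologicalSpace X] (α : Ordinal.{0}) : Prop :=
  ∀ A B : Set X, BorelMul X α A → BorelMul X α B → Disjoint A B → AlphaSeparated α A B

/-- `E` is `α`-embedded in `X`. -/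
def AlphaEmbedded {X : Type u} [TopologicalSpace X] (α : Ordinal.{0}) (E : Set X) : Prop :=
  (∀ A : Set ↥E, FunAdd ↥E α A → ∃ B : Set X, FunAdd X α B ∧ Subtype.val '' A = B ∩ E) ∧
  (∀ A : Set ↥E, FunMul ↥E α A → ∃ B : Set X, FunMul X α B ∧ Subtype.val '' A = B ∩ E)

/-- `E` is ambiguously `α`-embedded in `X`. -/
def AmbiguouslyEmbedded {X : Type u} [TopologicalSpace X] (α : Ordinal.{0}) (E : Set X) : Prop :=
  ∀ A : Set ↥E, FunAmbiguous ↥E α A →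
    ∃ B : Set X, FunAmbiguous X α B ∧ Subtype.val '' A = B ∩ E

/-- The first uncountable ordinal. -/
noncomputable def omega1 : Ordinal.{0} := (Cardinal.aleph 1).ord

/-- `A` is an `F_σ`-set: a countable union of closed sets. -/
def IsFSigma {X : Type u} [TopologicalSpace X] (A : Set X) : Prop :=
  ∃ F : ℕ → Set X, (∀ n, IsClosed (F n)) ∧ A = ⋃ n, F n

/-- A space has a countable π-base. -/
def CountablePiBase (Z : Type v) [TopologicalSpace Z] : Prop :=
  ∃ 𝒰 : Set (Set Z), 𝒰.Countable ∧ (∀ U ∈ 𝒰, IsOpen U ∧ U.Nonempty) ∧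
    ∀ V : Set Z, IsOpen V → V.Nonempty → ∃ U ∈ 𝒰, U ⊆ V

theorem funAdd_zero_aux {X : Type u} [TopologicalSpace X] {A : Set X} (h : FunAdd X 0 A) :
    FunctionallyOpen X A := by
  generalize hα : (0 : Ordinal.{0}) = α at h
  cases h with
  | base _ h => exact h
  | union _ h => exact absurd hα.symm h

theorem funMul_zero_aux {X : Type u} [TopologicalSpace X] {A : Set X} (h : FunMul X 0 A) :
    FunctionallyClosed X A := by
  generalize hα : (0 : Ordinal.{0}) = α at h
  cases h with
  | base _ h => exact h
  | inter _ h => exact absurd hα.symm h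

theorem extend_aux {X : Type u} [TopologicalSpace X] [NormalSpace X] {F : Set X}
    (hF : IsClosed F) (f : F → ℝ) (hf : Continuous f) (h01 : ∀ x, f x ∈ Set.Icc (0:ℝ) 1) :
    ∃ g : X → ℝ, Continuous g ∧ (∀ x, g x ∈ Set.Icc (0:ℝ) 1) ∧ ∀ x : F, g x = f x := by
  obtain ⟨g, hg⟩ := ContinuousMap.exists_restrict_eq hF (⟨f, hf⟩ : C(F, ℝ))
  refine ⟨fun x => max 0 (min 1 (g x)), by fun_prop, fun x => ⟨le_max_left _ _, ?_⟩, fun x => ?_⟩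
  · exact max_le zero_le_one (min_le_left _ _)
  · have h : g x = f x := DFunLike.congr_fun hg x
    show max 0 (min 1 (g x)) = f x
    rw [h, min_eq_right (h01 x).2, max_eq_right (h01 x).1]

theorem sep_aux {X : Type u} [TopologicalSpace X] {F A : Set X} (hF : AlphaEmbedded 0 F)
    (hA : IsClopen (Subtype.val ⁻¹' A : Set F)) :
    ∃ f : X → ℝ, Continuous f ∧ ∀ x ∈ F, (x ∈ A → 0 < f x) ∧ (x ∉ A → f x = 0) := by
  classical
  obtain ⟨B, hB, hBA⟩ := hF.1 (Subtype.val ⁻¹' A) (FunAdd.base _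
    ⟨(Subtype.val ⁻¹' A).indicator 1, (IsClopen.continuous_indicator hA continuous_one),
      fun x => by by_cases h : x ∈ (Subtype.val ⁻¹' A : Set F) <;> simp [Set.indicator, h],
      by ext x; by_cases h : (x : X) ∈ A <;> simp [Set.indicator, h]⟩)
  obtain ⟨f, hf, h01, rfl⟩ := funAdd_zero_aux hB
  refine ⟨f, hf, fun x hx => ⟨fun h => ?_, fun h => ?_⟩⟩
  · have : x ∈ f ⁻¹' Set.Ioc 0 1 ∩ F := hBA ▸ ⟨⟨x, hx⟩, h, rfl⟩
    exact this.1.1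
  · by_contra hne
    have : x ∈ f ⁻¹' Set.Ioc 0 1 ∩ F :=
      ⟨⟨lt_of_le_of_ne (h01 x).1 (Ne.symm hne), (h01 x).2⟩, hx⟩
    rw [← hBA] at this
    obtain ⟨y, hy, rfl⟩ := this
    exact h hy

/-- `X` is normal iff every closed subset of `X` is `0`-embedded in `X`. -/
theorem stmt5 {X : Type u} [TopologicalSpace X] :
    NormalSpace X ↔ ∀ F : Set X, IsClosed F → AlphaEmbedded 0 F := by
  constructor
  · intro hN F hF
    constructor
    · intro A hA
      obtain ⟨f, hf, h01, rfl⟩ := funAdd_zero_aux hA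
      obtain ⟨g, hg, hg01, hgf⟩ := extend_aux hF f hf h01
      refine ⟨_, FunAdd.base _ ⟨g, hg, hg01, rfl⟩, ?_⟩
      ext x
      constructor
      · rintro ⟨y, hy, rfl⟩
        exact ⟨by rw [Set.mem_preimage, hgf]; exact hy, y.2⟩
      · rintro ⟨h1, h2⟩
        exact ⟨⟨x, h2⟩, by rw [Set.mem_preimage, ← hgf]; exact h1, rfl⟩
    · intro A hA
      obtain ⟨f, hf, h01, rfl⟩ := funMul_zero_aux hA
      obtain ⟨g, hg, hg01, hgf⟩ := extend_aux hF f hf h01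
      refine ⟨_, FunMul.base _ ⟨g, hg, hg01, rfl⟩, ?_⟩
      ext x
      constructor
      · rintro ⟨y, hy, rfl⟩
        exact ⟨by rw [Set.mem_preimage, hgf]; exact hy, y.2⟩
      · rintro ⟨h1, h2⟩
        exact ⟨⟨x, h2⟩, by rw [Set.mem_preimage, ← hgf]; exact h1, rfl⟩
  · intro H
    refine ⟨fun A B hA hB hAB => ?_⟩
    have hE := H _ (hA.union hB)
    have hcA : IsClosed (Subtype.val ⁻¹' A : Set ↥(A ∪ B)) := hA.preimage continuous_subtype_val
    have hcB : IsClosed (Subtype.val ⁻¹' B : Set ↥(A ∪ B)) := hB.preimage continuous_subtype_val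
    have hc : (Subtype.val ⁻¹' A : Set ↥(A ∪ B))ᶜ = Subtype.val ⁻¹' B := by
      ext ⟨x, hx⟩
      constructor
      · intro h
        exact hx.resolve_left h
      · intro h h'
        exact Set.disjoint_left.1 hAB h' h
    have hoA : IsOpen (Subtype.val ⁻¹' A : Set ↥(A ∪ B)) := by
      rw [← isClosed_compl_iff, hc]; exact hcB
    have hoB : IsOpen (Subtype.val ⁻¹' B : Set ↥(A ∪ B)) := by
      rw [← hc]; exact hcA.isOpen_compl
    obtain ⟨f, hf, hf'⟩ := sep_aux hE ⟨hcA, hoA⟩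
    obtain ⟨g, hg, hg'⟩ := sep_aux hE ⟨hcB, hoB⟩
    refine ⟨{x | g x < f x}, {x | f x < g x}, isOpen_lt hg hf, isOpen_lt hf hg, ?_, ?_, ?_⟩
    · intro x hx
      show g x < f x
      rw [(hg' x (Or.inl hx)).2 (Set.disjoint_left.1 hAB hx)]
      exact (hf' x (Or.inl hx)).1 hx
    · intro x hx
      show f x < g x
      rw [(hf' x (Or.inr hx)).2 (Set.disjoint_right.1 hAB hx)]
      exact (hg' x (Or.inr hx)).1 hx
    · exact Set.disjoint_left.2 fun x (h1 : g x < f x) (h2 : f x < g x) => lt_asymm h1 h2
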